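/- arXiv:2402.09810 — 3 statements merged into one kernel-verified Lean document; each statement's English description precedes it below -/
import Mathlib

section
/- Let N be a positive integer and let u_1, …, u_N be unit vectors in ℝ³. Define the 3×3 real matrix M = Σ_{n=1}^N u_n u_nᵀ (the sum of the outer products of the u_n with themselves). If M is positive definite, then the trace of M⁻¹ satisfies trace(M⁻¹) ≥ 9/N. -/
open scoped Matrix in
/-- A real positive definite matrix satisfies `n² ≤ tr A * tr A⁻¹`, where `n` is its size. -/
theorem Matrix.PosDef.card_sq_le_trace_mul_trace_inv {n : Type*} [Fintype n] [DecidableEq n]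
    [Nonempty n] {A : Matrix n n ℝ} (hA : A.PosDef) :
    (Fintype.card n : ℝ) ^ 2 ≤ A.trace * A⁻¹.trace := by
  have ht : 0 < A.trace := hA.trace_pos
  have hdet : IsUnit A.det := (Matrix.isUnit_iff_isUnit_det A).mp hA.isUnit
  set t := A.trace with ht_def
  set k : ℝ := (Fintype.card n : ℝ) with hk
  have hnonneg := (hA.inv.posSemidef.mul_mul_conjTranspose_same
    (t • (1 : Matrix n n ℝ) - k • A)).trace_nonneg
  have hexpand : (t • (1 : Matrix n n ℝ) - k • A) * A⁻¹ * (t • (1 : Matrix n n ℝ) - k • A)ᴴ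
      = t ^ 2 • A⁻¹ - (2 * t * k) • (1 : Matrix n n ℝ) + k ^ 2 • A := by
    simp only [Matrix.conjTranspose_sub, Matrix.conjTranspose_smul, Matrix.conjTranspose_one,
      hA.isHermitian.eq, star_trivial, sub_mul, mul_sub, smul_mul_assoc, mul_smul_comm, one_mul,
      mul_one, Matrix.mul_nonsing_inv A hdet, Matrix.nonsing_inv_mul A hdet]
    module
  rw [hexpand] at hnonneg
  simp only [Matrix.trace_add, Matrix.trace_sub, Matrix.trace_smul, Matrix.trace_one,
    smul_eq_mul, ← hk, ← ht_def] at hnonneg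
  have hmul : 0 ≤ t * (t * A⁻¹.trace - k ^ 2) := by linarith
  linarith [nonneg_of_mul_nonneg_right hmul ht]


/-- For `N` unit vectors `u n` in `ℝ³`, if `M = ∑ n, u n (u n)ᵀ`
is positive definite, then `trace M⁻¹ ≥ 9 / N`. -/
theorem crlb_trace_inv_ge (N : ℕ) (hN : 0 < N) (u : Fin N → Fin 3 → ℝ)
    (hu : ∀ n, ∑ i, (u n i) ^ 2 = 1)
    (M : Matrix (Fin 3) (Fin 3) ℝ)
    (hM : M = ∑ n, Matrix.vecMulVec (u n) (u n))
    (hpd : M.PosDef) :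
    9 / (N : ℝ) ≤ (M⁻¹).trace := by
  have htrace : M.trace = N := by
    simp only [hM, Matrix.trace_sum, Matrix.trace_vecMulVec, dotProduct, ← pow_two, hu]
    simp
  have h := hpd.card_sq_le_trace_mul_trace_inv
  rw [htrace, Fintype.card_fin] at h
  rw [div_le_iff₀' (Nat.cast_pos.mpr hN)]
  norm_num at h
  exact h
end

section
/- Let N be a positive integer and let v_1, …, v_N ∈ ℝ³ be vectors whose third coordinate is zero (v_{n,3} = 0 for all n). Then for the matrix M = Σ_{n=1}^N v_n v_nᵀ, the trace of its adjugate reduces to the xy-minor contribution only: trace(adj M) = Σ_{1 ≤ n < m ≤ N} (v_{n,1} v_{m,2} − v_{n,2} v_{m,1})². -/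
/-- Lagrange's identity. -/
theorem sum_sq_mul_sum_sq_sub_sq_sum_mul {R : Type*} [CommRing R] {N : ℕ} (a b : Fin N → R) :
    (∑ n, a n ^ 2) * (∑ n, b n ^ 2) - (∑ n, a n * b n) ^ 2 =
      ∑ n : Fin N, ∑ m ∈ Finset.Ioi n, (a n * b m - b n * a m) ^ 2 := by
  induction N with
  | zero => simp
  | succ N ih =>
    have h := ih (fun n => a n.succ) (fun n => b n.succ)
    have hcross : ∑ m : Fin N, (a 0 * b m.succ - b 0 * a m.succ) ^ 2 =
        a 0 ^ 2 * ∑ m : Fin N, b m.succ ^ 2 + b 0 ^ 2 * ∑ m : Fin N, a m.succ ^ 2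
          - 2 * a 0 * b 0 * ∑ m : Fin N, a m.succ * b m.succ := by
      simp only [Finset.mul_sum, ← Finset.sum_add_distrib, ← Finset.sum_sub_distrib]
      exact Finset.sum_congr rfl fun m _ => by ring
    simp only [Fin.sum_univ_succ, Fin.sum_Ioi_zero, Fin.sum_Ioi_succ]
    rw [hcross, ← h]
    ring

/-- if all `v n ∈ ℝ³` have vanishing third coordinate, then for
`M = ∑ n, v n (v n)ᵀ` the trace of the adjugate reduces to the xy-minor
contribution only. -/
theorem trace_adjugate_gram_of_horizontal (N : ℕ) (hN : 0 < N) (v : Fin N → Fin 3 → ℝ)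
    (hv : ∀ n, v n 2 = 0)
    (M : Matrix (Fin 3) (Fin 3) ℝ)
    (hM : M = ∑ n, Matrix.vecMulVec (v n) (v n)) :
    M.adjugate.trace = ∑ n : Fin N, ∑ m ∈ Finset.Ioi n,
      (v n 0 * v m 1 - v n 1 * v m 0) ^ 2 := by
  have hentry (i j : Fin 3) : M i j = ∑ n, v n i * v n j := by
    simp [hM, Matrix.sum_apply, Matrix.vecMulVec_apply]
  rw [← sum_sq_mul_sum_sq_sub_sq_sum_mul (fun n => v n 0) (fun n => v n 1),
    Matrix.adjugate_fin_three, Matrix.trace_fin_three]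
  simp [hentry, hv, mul_comm (v _ 1), sq]
end

section
/- Let c > 0 and let P : ℝ → ℝ be differentiable. Define the attack effectiveness under detection E_d(A) = c·A·(1 − P(A)). Then for A* > 0, the derivative E_d'(A*) = 0 if and only if A*·P'(A*) = 1 − P(A*). Moreover, if in addition P is concave on [0, ∞) and P(0) ≥ 0, then every A* > 0 with E_d'(A*) = 0 satisfies P(A*) ≥ 1/2. -/
theorem deriv_mul_one_sub_eq_zero_iff {c : ℝ} (hc : c ≠ 0) {P : ℝ → ℝ} {A : ℝ}
    (hP : DifferentiableAt ℝ P A) :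
    deriv (fun A => c * A * (1 - P A)) A = 0 ↔ A * deriv P A = 1 - P A := by
  have h : HasDerivAt (fun A => c * A * (1 - P A))
      (c * 1 * (1 - P A) + c * A * (-deriv P A)) A :=
    ((hasDerivAt_id A).const_mul c).mul (hP.hasDerivAt.const_sub 1)
  have hfac : c * 1 * (1 - P A) + c * A * (-deriv P A) = c * (1 - P A - A * deriv P A) := by
    ring
  rw [h.deriv, hfac, mul_eq_zero, or_iff_right hc, sub_eq_zero, eq_comm]

/-- for attack effectiveness `E_d A = c * A * (1 - P A)` with
`c > 0` and `P` differentiable, a point `A* > 0` is critical iff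
`A* * P'(A*) = 1 - P(A*)`; moreover if `P` is concave on `[0, ∞)` with
`P 0 ≥ 0`, then any critical point `A* > 0` satisfies `P A* ≥ 1/2`. -/
theorem optimal_attack_parameter (c : ℝ) (hc : 0 < c) (P : ℝ → ℝ)
    (hP : Differentiable ℝ P) :
    (∀ A > (0 : ℝ),
      deriv (fun A => c * A * (1 - P A)) A = 0 ↔ A * deriv P A = 1 - P A) ∧
    (ConcaveOn ℝ (Set.Ici 0) P → 0 ≤ P 0 →
      ∀ A > (0 : ℝ), deriv (fun A => c * A * (1 - P A)) A = 0 → (1 : ℝ) / 2 ≤ P A) := by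
  have hiff (A : ℝ) := deriv_mul_one_sub_eq_zero_iff hc.ne' (hP A)
  refine ⟨fun A _ => hiff A, fun hconc hP0 A hA hcrit => ?_⟩
  have hslope := hconc.deriv_le_slope Set.self_mem_Ici hA.le hA (hP A)
  rw [slope_def_field, sub_zero, le_div_iff₀ hA] at hslope
  linarith [(hiff A).1 hcrit]
end
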